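/- Each norm-4 vector of E8 can be written as a sum r_a + r_b of two orthogonal norm-2 vectors in exactly 7 ways. -/

import Mathlib

/-- The `E₈` lattice: vectors in `ℚ⁸` whose coordinates are all integers or all
half-odd-integers, with coordinate sum an even integer. -/
def E8 : Set (Fin 8 → ℚ) :=
  {v | ((∀ i, ∃ n : ℤ, v i = n) ∨ (∀ i, ∃ n : ℤ, v i = n + 1/2)) ∧
    ∃ m : ℤ, (∑ i, v i) = 2 * m}

/-- The standard inner product on `ℚ⁸`. -/
def ip (v w : Fin 8 → ℚ) : ℚ := ∑ i, v i * w i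

/-- The unordered decompositions of `v` into two orthogonal norm-2 vectors of `E₈`. -/
def orthogonalDecompositions (v : Fin 8 → ℚ) : Set (Set (Fin 8 → ℚ)) :=
  {P | ∃ r s : Fin 8 → ℚ, r ∈ E8 ∧ s ∈ E8 ∧
    ip r r = 2 ∧ ip s s = 2 ∧ ip r s = 0 ∧ r + s = v ∧ P = {r, s}}

lemma ip_add_left (u v w : Fin 8 → ℚ) : ip (u + v) w = ip u w + ip v w := by
  simp [ip, add_mul, Finset.sum_add_distrib]

lemma ip_sub_left (u v w : Fin 8 → ℚ) : ip (u - v) w = ip u w - ip v w := by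
  simp [ip, sub_mul, Finset.sum_sub_distrib]

lemma ip_smul_left (c : ℚ) (v w : Fin 8 → ℚ) : ip (c • v) w = c * ip v w := by
  simp [ip, Finset.mul_sum, mul_assoc]

lemma ip_comm (v w : Fin 8 → ℚ) : ip v w = ip w v := by
  simp [ip, mul_comm]

lemma ip_single_right (v : Fin 8 → ℚ) (i : Fin 8) (c : ℚ) : ip v (Pi.single i c) = v i * c := by
  simp [ip, Pi.single_apply]

lemma E8_add_mem {u v : Fin 8 → ℚ} (hu : u ∈ E8) (hv : v ∈ E8) : u + v ∈ E8 := by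
  obtain ⟨hu, a, ha⟩ := hu
  obtain ⟨hv, b, hb⟩ := hv
  refine ⟨?_, a + b, by simp [Finset.sum_add_distrib, ha, hb, mul_add]⟩
  rcases hu with hu | hu <;> rcases hv with hv | hv <;> choose m hm using hu <;>
    choose n hn using hv
  · exact .inl fun i => ⟨m i + n i, by simp [hm, hn]⟩
  · exact .inr fun i => ⟨m i + n i, by simp [hm, hn]; ring⟩
  · exact .inr fun i => ⟨m i + n i, by simp [hm, hn]; ring⟩
  · exact .inl fun i => ⟨m i + n i + 1, by simp [hm, hn]; ring⟩

lemma E8_neg_mem {v : Fin 8 → ℚ} (hv : v ∈ E8) : -v ∈ E8 := by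
  obtain ⟨hv, b, hb⟩ := hv
  refine ⟨?_, -b, by simp [hb]⟩
  rcases hv with hv | hv <;> choose n hn using hv
  · exact .inl fun i => ⟨-n i, by simp [hn]⟩
  · exact .inr fun i => ⟨-n i - 1, by simp [hn]; ring⟩

/-- The `E₈` lattice as an additive subgroup of `ℚ⁸`. -/
def E8Subgroup : AddSubgroup (Fin 8 → ℚ) where
  carrier := E8
  add_mem' := E8_add_mem
  zero_mem' := ⟨.inl fun _ => ⟨0, by simp⟩, 0, by simp⟩
  neg_mem' := E8_neg_mem

lemma E8_sub_mem {u v : Fin 8 → ℚ} (hu : u ∈ E8) (hv : v ∈ E8) : u - v ∈ E8 :=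
  E8Subgroup.sub_mem hu hv

lemma exists_int_ip_of_int {u v : Fin 8 → ℚ} (hu : ∀ i, ∃ n : ℤ, u i = n)
    (hu' : ∃ m : ℤ, ∑ i, u i = 2 * m) (hv : v ∈ E8) : ∃ k : ℤ, ip u v = k := by
  choose m hm using hu
  obtain ⟨a, ha⟩ := hu'
  rcases hv.1 with hv | hv <;> choose n hn using hv
  · exact ⟨∑ i, m i * n i, by simp [ip, hm, hn]⟩
  · refine ⟨∑ i, m i * n i + a, ?_⟩
    have h : ip u v = ∑ i, (m i : ℚ) * n i + (∑ i, u i) / 2 := by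
      simp [ip, hm, hn, mul_add, Finset.sum_add_distrib, div_eq_mul_inv,
        Finset.sum_mul]
    rw [h, ha]
    push_cast
    ring

lemma exists_int_ip {u v : Fin 8 → ℚ} (hu : u ∈ E8) (hv : v ∈ E8) : ∃ k : ℤ, ip u v = k := by
  rcases hu.1 with hu' | hu'
  · exact exists_int_ip_of_int hu' hu.2 hv
  rcases hv.1 with hv' | hv'
  · rw [ip_comm]
    exact exists_int_ip_of_int hv' hv.2 hu
  choose m hm using hu'
  choose n hn using hv'
  obtain ⟨a, ha⟩ := hu.2
  obtain ⟨b, hb⟩ := hv.2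
  refine ⟨∑ i, m i * n i + a + b - 2, ?_⟩
  have h : ip u v = ∑ i, (m i : ℚ) * n i + (∑ i, u i) / 2 + (∑ i, v i) / 2 - 2 := by
    simp only [ip, hm, hn, Fin.sum_univ_eight]
    ring
  rw [h, ha, hb]
  push_cast
  ring

/-- The reflection in the hyperplane orthogonal to a vector `w` of norm 2. -/
def rootReflection (w x : Fin 8 → ℚ) : Fin 8 → ℚ := x - ip x w • w

lemma rootReflection_mem {w x : Fin 8 → ℚ} (hw : w ∈ E8) (hx : x ∈ E8) :
    rootReflection w x ∈ E8 := by
  obtain ⟨k, hk⟩ := exists_int_ip hx hw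
  rw [rootReflection, hk, Int.cast_smul_eq_zsmul]
  exact E8_sub_mem hx (E8Subgroup.zsmul_mem hw k)

lemma ip_rootReflection {w : Fin 8 → ℚ} (hw : ip w w = 2) (x y : Fin 8 → ℚ) :
    ip (rootReflection w x) (rootReflection w y) = ip x y := by
  simp only [rootReflection]
  rw [ip_sub_left, ip_smul_left, ip_comm x, ip_comm w, ip_sub_left, ip_sub_left, ip_smul_left,
    ip_smul_left, hw, ip_comm w x, ip_comm y x]
  ring

lemma rootReflection_add (w x y : Fin 8 → ℚ) :
    rootReflection w (x + y) = rootReflection w x + rootReflection w y := by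
  simp only [rootReflection, ip_add_left, add_smul]
  abel

lemma rootReflection_involutive {w : Fin 8 → ℚ} (hw : ip w w = 2) :
    Function.Involutive (rootReflection w) := by
  intro x
  ext i
  simp only [rootReflection, ip_sub_left, ip_smul_left, hw, Pi.sub_apply, Pi.smul_apply,
    smul_eq_mul]
  ring

lemma image_rootReflection_mem {w v : Fin 8 → ℚ} (hw : w ∈ E8) (hw2 : ip w w = 2)
    {P : Set (Fin 8 → ℚ)} (hP : P ∈ orthogonalDecompositions v) :
    rootReflection w '' P ∈ orthogonalDecompositions (rootReflection w v) := by
  obtain ⟨r, s, hr, hs, hrr, hss, hrs, rfl, rfl⟩ := hP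
  exact ⟨rootReflection w r, rootReflection w s, rootReflection_mem hw hr,
    rootReflection_mem hw hs, by rwa [ip_rootReflection hw2], by rwa [ip_rootReflection hw2],
    by rwa [ip_rootReflection hw2], (rootReflection_add w r s).symm, Set.image_pair _ _ _⟩

lemma ncard_orthogonalDecompositions_rootReflection {w : Fin 8 → ℚ} (hw : w ∈ E8)
    (hw2 : ip w w = 2) (v : Fin 8 → ℚ) :
    (orthogonalDecompositions (rootReflection w v)).ncard =
      (orthogonalDecompositions v).ncard := by
  have hinv := rootReflection_involutive hw2
  have h : orthogonalDecompositions (rootReflection w v) =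
      Set.image (rootReflection w) '' orthogonalDecompositions v := by
    ext P
    constructor
    · intro hP
      refine ⟨rootReflection w '' P, ?_, ?_⟩
      · simpa only [hinv v] using image_rootReflection_mem hw hw2 hP
      · rw [Set.image_image]
        simp [hinv _]
    · rintro ⟨Q, hQ, rfl⟩
      exact image_rootReflection_mem hw hw2 hQ
  rw [h, Set.ncard_image_of_injective _ hinv.injective.image_injective]

/-- If `⟨v, w⟩ = 1` for a root `w`, then `v` and `v - w` have equally many decompositions. -/
lemma ncard_orthogonalDecompositions_sub {v w : Fin 8 → ℚ} (hw : w ∈ E8)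
    (hw2 : ip w w = 2) (hvw : ip v w = 1) :
    (orthogonalDecompositions (v - w)).ncard = (orthogonalDecompositions v).ncard := by
  simpa [rootReflection, hvw] using ncard_orthogonalDecompositions_rootReflection hw hw2 v

lemma single_add_single_mem (i j : Fin 8) {a b : ℤ} (h : Even (a + b)) :
    (Pi.single i (a : ℚ) + Pi.single j (b : ℚ) : Fin 8 → ℚ) ∈ E8 := by
  obtain ⟨m, hm⟩ := h
  refine ⟨.inl fun k => ⟨(if k = i then a else 0) + (if k = j then b else 0), ?_⟩, m, ?_⟩
  · simp [Pi.single_apply]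
  · simp only [Pi.add_apply, Finset.sum_add_distrib, Finset.sum_pi_single', Finset.mem_univ,
      if_true]
    rw [two_mul]
    exact_mod_cast hm

lemma exists_of_sum_sq_eq_one {ι : Type*} [DecidableEq ι] {s : Finset ι} {n : ι → ℤ}
    (h : ∑ i ∈ s, n i ^ 2 = 1) :
    ∃ j ∈ s, (n j = 1 ∨ n j = -1) ∧ ∀ k ∈ s, k ≠ j → n k = 0 := by
  obtain ⟨j, hj, hnj⟩ := Finset.exists_ne_zero_of_sum_ne_zero (by rw [h]; exact one_ne_zero)
  have hpos : 0 < n j ^ 2 := lt_of_le_of_ne (sq_nonneg _) hnj.symm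
  have hsplit := Finset.add_sum_erase s (fun i => n i ^ 2) hj
  have hrest : 0 ≤ ∑ i ∈ s.erase j, n i ^ 2 := Finset.sum_nonneg fun _ _ => sq_nonneg _
  simp only [h] at hsplit
  refine ⟨j, hj, ?_, fun k hk hkj => ?_⟩
  · have h1 : n j ^ 2 = 1 := by omega
    simpa using h1
  · have h0 : ∑ i ∈ s.erase j, n i ^ 2 = 0 := by omega
    rw [Finset.sum_eq_zero_iff_of_nonneg fun _ _ => sq_nonneg _] at h0
    simpa using h0 k (Finset.mem_erase.mpr ⟨hkj, hk⟩)

lemma orthogonalDecompositions_single (i : Fin 8) {ε : ℤ} (hε : ε = 1 ∨ ε = -1) :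
    orthogonalDecompositions (Pi.single i (2 * ε : ℚ)) =
      (fun j => {Pi.single i (ε : ℚ) + Pi.single j 1, Pi.single i (ε : ℚ) + Pi.single j (-1)}) ''
        {j | j ≠ i} := by
  have hεε : (ε : ℚ) * ε = 1 := by rcases hε with rfl | rfl <;> norm_num
  ext P
  constructor
  · rintro ⟨r, s, hr, -, hrr, -, hrs, hsum, rfl⟩
    have hri : r i = ε := by
      have h : ip r (r + s) = 2 := by
        rw [ip_comm, ip_add_left, hrr, ip_comm, hrs, add_zero]
      rw [hsum, ip_single_right] at h
      linear_combination (ε / 2 : ℚ) * h - r i * hεε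
    have hint : ∀ k, ∃ n : ℤ, r k = n := by
      rcases hr.1 with h | h
      · exact h
      · obtain ⟨n, hn⟩ := h i
        have : (2 * ε : ℚ) = 2 * n + 1 := by linarith
        norm_cast at this
        omega
    choose n hn using hint
    have hsq : ∑ k ∈ Finset.univ.erase i, n k ^ 2 = 1 := by
      have h2 : ∑ k, n k ^ 2 = 2 := by
        simp only [ip, hn, ← sq] at hrr
        exact_mod_cast hrr
      rw [← Finset.add_sum_erase _ _ (Finset.mem_univ i)] at h2
      have : n i = ε := by exact_mod_cast (hn i).symm.trans hri
      have : n i ^ 2 = 1 := by rw [this]; rcases hε with rfl | rfl <;> rfl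
      omega
    obtain ⟨j, hj, hnj, hzero⟩ := exists_of_sum_sq_eq_one hsq
    have hji : j ≠ i := Finset.ne_of_mem_erase hj
    have hreq : r = Pi.single i (ε : ℚ) + Pi.single j (n j : ℚ) := by
      ext k
      by_cases hki : k = i
      · subst hki; simp [hri, hji.symm]
      by_cases hkj : k = j
      · subst hkj; simp [hn, hki]
      · simp [hn, hki, hkj, hzero k (by simp [hki]) hkj]
    have hseq : s = Pi.single i (ε : ℚ) + Pi.single j (-n j : ℚ) := by
      rw [← eq_sub_iff_add_eq'] at hsum
      rw [hsum, hreq, two_mul, Pi.single_add, Pi.single_neg]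
      abel
    refine ⟨j, hji, ?_⟩
    rcases hnj with h | h
    · simp [hreq, hseq, h]
    · simp [hreq, hseq, h, Set.pair_comm]
  · rintro ⟨j, hji, rfl⟩
    have hji : j ≠ i := hji
    refine ⟨_, _, ?_, ?_, ?_, ?_, ?_, ?_, rfl⟩
    · simpa using single_add_single_mem i j (a := ε) (b := 1)
        (by rcases hε with rfl | rfl <;> decide)
    · simpa using single_add_single_mem i j (a := ε) (b := -1)
        (by rcases hε with rfl | rfl <;> decide)
    · rw [ip_add_left, ip_comm, ip_single_right, ip_comm, ip_single_right]
      simp [hji, hji.symm, hεε]; norm_num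
    · rw [ip_add_left, ip_comm, ip_single_right, ip_comm, ip_single_right]
      simp [hji, hji.symm, hεε]; norm_num
    · rw [ip_add_left, ip_comm, ip_single_right, ip_comm, ip_single_right]
      simp [hji, hji.symm, hεε]
    · rw [two_mul, Pi.single_add, Pi.single_neg]
      abel

lemma ncard_orthogonalDecompositions_single (i : Fin 8) {ε : ℤ} (hε : ε = 1 ∨ ε = -1) :
    (orthogonalDecompositions (Pi.single i (2 * ε : ℚ))).ncard = 7 := by
  rw [orthogonalDecompositions_single i hε, Set.InjOn.ncard_image]
  · rw [Set.ncard_eq_toFinset_card']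
    simp [Finset.filter_ne']
  · intro j hj k _ hjk
    have hmem : (Pi.single i (ε : ℚ) + Pi.single j 1 : Fin 8 → ℚ) ∈
        ({Pi.single i (ε : ℚ) + Pi.single k 1, Pi.single i (ε : ℚ) + Pi.single k (-1)} :
          Set (Fin 8 → ℚ)) := by
      simp only at hjk
      rw [← hjk]
      exact Set.mem_insert _ _
    by_contra hne
    rcases hmem with h | h <;> simpa [hne] using congrFun h j

lemma ncard_orthogonalDecompositions_of_apply_eq {v : Fin 8 → ℚ} (hv : v ∈ E8)
    (hv4 : ip v v = 4) (i : Fin 8) {ε : ℤ} (hε : ε = 1 ∨ ε = -1) (hvi : v i = 3 / 2 * ε) :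
    (orthogonalDecompositions v).ncard = 7 := by
  have hεε : (ε : ℚ) * ε = 1 := by rcases hε with rfl | rfl <;> norm_num
  have hmem : (Pi.single i (2 * ε : ℚ) : Fin 8 → ℚ) ∈ E8 := by
    rw [two_mul, Pi.single_add]
    exact single_add_single_mem i i ⟨ε, rfl⟩
  have hvw : ip v (v - Pi.single i (2 * ε : ℚ)) = 1 := by
    rw [ip_comm, ip_sub_left, hv4, ip_comm, ip_single_right, hvi]
    linear_combination -3 * hεε
  have hw2 : ip (v - Pi.single i (2 * ε : ℚ)) (v - Pi.single i (2 * ε : ℚ)) = 2 := by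
    rw [ip_sub_left, hvw, ip_comm, ip_single_right]
    simp only [Pi.sub_apply, Pi.single_eq_same, hvi]
    linear_combination hεε
  have h := ncard_orthogonalDecompositions_sub (E8_sub_mem hv hmem) hw2 hvw
  rw [sub_sub_cancel] at h
  rw [← h, ncard_orthogonalDecompositions_single i hε]

lemma ncard_orthogonalDecompositions_of_half {v : Fin 8 → ℚ} (hv : v ∈ E8)
    (hv4 : ip v v = 4) (hhalf : ∀ i, ∃ n : ℤ, v i = n + 1 / 2) :
    (orthogonalDecompositions v).ncard = 7 := by
  choose n hn using hhalf
  have hsum : ∑ i, n i * (n i + 1) = 2 := by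
    have h : ip v v = ∑ i, (n i : ℚ) * (n i + 1) + 2 := by
      simp only [ip, hn, Fin.sum_univ_eight]
      ring
    have : ∑ i, (n i : ℚ) * (n i + 1) = 2 := by linarith
    exact_mod_cast this
  have hnonneg : ∀ i, 0 ≤ n i * (n i + 1) := fun i => by
    rcases lt_or_ge (n i) 0 with h | h <;> nlinarith
  obtain ⟨i, -, hi⟩ := Finset.exists_ne_zero_of_sum_ne_zero (by rw [hsum]; exact two_ne_zero)
  have hle : n i * (n i + 1) ≤ 2 :=
    hsum ▸ Finset.single_le_sum (fun j _ => hnonneg j) (Finset.mem_univ i)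
  have hcases : n i = 1 ∨ n i = -2 := by
    have h1 : n i ≤ 1 := by nlinarith
    have h2 : -2 ≤ n i := by nlinarith
    generalize n i = m at *
    interval_cases m <;> simp_all
  rcases hcases with h | h
  · exact ncard_orthogonalDecompositions_of_apply_eq hv hv4 i (.inl rfl)
      (by rw [hn, h]; norm_num)
  · exact ncard_orthogonalDecompositions_of_apply_eq hv hv4 i (.inr rfl)
      (by rw [hn, h]; norm_num)

/-- An element of `(ℤ + 1/2)⁸` lies in `E₈` after possibly subtracting a given unit vector. -/
lemma mem_or_sub_single_mem {w : Fin 8 → ℚ} (hw : ∀ i, ∃ n : ℤ, w i = n + 1 / 2) (k : Fin 8) :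
    w ∈ E8 ∨ w - Pi.single k 1 ∈ E8 := by
  choose n hn using hw
  have hsum : ∑ i, w i = ((∑ i, n i : ℤ) : ℚ) + 4 := by
    simp only [hn, Fin.sum_univ_eight]
    push_cast
    ring
  rcases Int.even_or_odd' (∑ i, n i) with ⟨m, hm | hm⟩ <;> rw [hm] at hsum
  · refine .inl ⟨.inr fun i => ⟨n i, hn i⟩, m + 2, ?_⟩
    rw [hsum]; push_cast; ring
  · refine .inr ⟨.inr fun i => ⟨n i - if i = k then 1 else 0, ?_⟩, m + 2, ?_⟩
    · simp [hn, Pi.single_apply]; ring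
    · simp only [Pi.sub_apply, Finset.sum_sub_distrib, hsum, Finset.sum_pi_single',
        Finset.mem_univ, if_true]
      push_cast; ring

lemma exists_half_root {v : Fin 8 → ℚ} (hv4 : ip v v = 4)
    (hsmall : ∀ j, v j = 0 ∨ v j = 1 ∨ v j = -1) {i k : Fin 8} (hi : v i ≠ 0) (hk : v k = 0) :
    ∃ w ∈ E8, ip w w = 2 ∧ ip v w = 1 ∧ ∀ j, ∃ n : ℤ, w j = n + 1 / 2 := by
  have hki : i ≠ k := fun h => hi (h ▸ hk)
  have hvi : v i * v i = 1 := by rcases hsmall i with h | h | h <;> simp_all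
  have key : ∀ w : Fin 8 → ℚ, (∀ j, w j = 1 / 2 ∨ w j = -1 / 2) →
      (∀ j, v j * w j = v j * v j / 2 - if j = i then 1 else 0) →
      ip w w = 2 ∧ ip v w = 1 ∧ ∀ j, ∃ n : ℤ, w j = n + 1 / 2 := by
    intro w hw hvw
    refine ⟨?_, ?_, fun j => ?_⟩
    · have : ∀ j, w j * w j = 1 / 4 := fun j => by rcases hw j with h | h <;> rw [h] <;> norm_num
      simp [ip, this]; norm_num
    · simp only [ip] at hv4
      simp only [ip, hvw, Finset.sum_sub_distrib, ← Finset.sum_div, hv4]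
      simp; norm_num
    · rcases hw j with h | h
      · exact ⟨0, by rw [h]; norm_num⟩
      · exact ⟨-1, by rw [h]; norm_num⟩
  set w : Fin 8 → ℚ := fun j => if j = i then -v i / 2 else if v j = 0 then 1 / 2 else v j / 2
    with hwdef
  have hw : ∀ j, w j = 1 / 2 ∨ w j = -1 / 2 := by
    intro j
    simp only [hwdef]
    split_ifs with h1 h2
    · rcases hsmall i with h | h | h
      · exact absurd h hi
      · right; rw [h]
      · left; rw [h]; norm_num
    · exact .inl rfl
    · rcases hsmall j with h | h | h
      · exact absurd h h2
      · left; rw [h]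
      · right; rw [h]
  have hvw : ∀ j, v j * w j = v j * v j / 2 - if j = i then 1 else 0 := by
    intro j
    simp only [hwdef]
    split_ifs with h1 h2
    · subst h1; linear_combination -hvi
    · rw [h2]; norm_num
    · ring
  have hwk : w k = 1 / 2 := by simp [hwdef, hki.symm, hk]
  have hkey := key w hw hvw
  rcases mem_or_sub_single_mem hkey.2.2 k with hmem | hmem
  · exact ⟨w, hmem, hkey⟩
  · refine ⟨_, hmem, key _ (fun j => ?_) (fun j => ?_)⟩
    · by_cases hjk : j = k
      · subst hjk; right; simp [hwk]; norm_num
      · simpa [hjk] using hw j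
    · by_cases hjk : j = k
      · subst hjk; simp [hk, hki.symm]
      · simpa [hjk] using hvw j

lemma ncard_orthogonalDecompositions_of_int {v : Fin 8 → ℚ} (hv : v ∈ E8)
    (hv4 : ip v v = 4) (hint : ∀ i, ∃ n : ℤ, v i = n) :
    (orthogonalDecompositions v).ncard = 7 := by
  choose n hn using hint
  have hsum : ∑ i, n i ^ 2 = 4 := by
    simp only [ip, hn, ← sq] at hv4
    exact_mod_cast hv4
  by_cases hbig : ∃ i, n i ^ 2 = 4
  · obtain ⟨i, hi⟩ := hbig
    have hzero : ∑ k ∈ Finset.univ.erase i, n k ^ 2 = 0 := by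
      rw [← Finset.add_sum_erase _ _ (Finset.mem_univ i)] at hsum
      omega
    rw [Finset.sum_eq_zero_iff_of_nonneg fun _ _ => sq_nonneg _] at hzero
    obtain ⟨ε, hε, hni⟩ : ∃ ε : ℤ, (ε = 1 ∨ ε = -1) ∧ n i = 2 * ε := by
      rcases sq_eq_sq_iff_eq_or_eq_neg.mp (hi.trans (by norm_num : (4 : ℤ) = 2 ^ 2)) with h | h
      · exact ⟨1, .inl rfl, h⟩
      · exact ⟨-1, .inr rfl, h⟩
    have hveq : v = Pi.single i (2 * ε : ℚ) := by
      ext k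
      by_cases hki : k = i
      · subst hki; simp [hn, hni]
      · simpa [hn, hki] using hzero k (by simp [hki])
    rw [hveq, ncard_orthogonalDecompositions_single i hε]
  · push Not at hbig
    have hsmallInt : ∀ j, n j = 0 ∨ n j = 1 ∨ n j = -1 := fun j => by
      have hle : n j ^ 2 ≤ 4 :=
        hsum ▸ Finset.single_le_sum (fun j _ => sq_nonneg (n j)) (Finset.mem_univ j)
      have hne := hbig j
      have h1 : n j ≤ 2 := by nlinarith
      have h2 : -2 ≤ n j := by nlinarith
      generalize n j = m at *
      interval_cases m <;> simp_all
    have hsmall : ∀ j, v j = 0 ∨ v j = 1 ∨ v j = -1 := fun j => by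
      rw [hn]; exact_mod_cast hsmallInt j
    obtain ⟨i, hi⟩ : ∃ i, v i ≠ 0 := by
      by_contra! h
      simp [ip, h] at hv4
    obtain ⟨k, hk⟩ : ∃ k, v k = 0 := by
      by_contra! h
      have : ∀ j, v j * v j = 1 := fun j => by
        rcases hsmall j with h' | h' | h'
        · exact absurd h' (h j)
        all_goals rw [h']; norm_num
      simp [ip, this] at hv4
    obtain ⟨w, hw, hw2, hvw, hhalf⟩ := exists_half_root hv4 hsmall hi hk
    rw [← ncard_orthogonalDecompositions_sub hw hw2 hvw]
    refine ncard_orthogonalDecompositions_of_half (E8_sub_mem hv hw) ?_ fun j => ?_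
    · rw [ip_sub_left, ip_comm v, ip_comm w (v - w), ip_sub_left, ip_sub_left, hv4, hw2,
        ip_comm w v, hvw]
      norm_num
    · obtain ⟨m, hm⟩ := hhalf j
      exact ⟨n j - m - 1, by simp [hn, hm]; ring⟩

/-- Each norm-4 vector of `E₈` can be written as a sum `r + s` of two orthogonal norm-2
vectors in exactly 7 ways (unordered pairs `{r, s}`). -/
theorem stmt15 (v : Fin 8 → ℚ) (hv : v ∈ E8) (hv4 : ip v v = 4) :
    {P : Set (Fin 8 → ℚ) | ∃ r s : Fin 8 → ℚ, r ∈ E8 ∧ s ∈ E8 ∧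
      ip r r = 2 ∧ ip s s = 2 ∧ ip r s = 0 ∧ r + s = v ∧ P = {r, s}}.ncard = 7 := by
  rcases hv.1 with h | h
  · exact ncard_orthogonalDecompositions_of_int hv hv4 h
  · exact ncard_orthogonalDecompositions_of_half hv hv4 h
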